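/- arXiv:1907.07021 — 2 statements merged into one kernel-verified Lean document; each statement's English description precedes it below -/
import Mathlib

section
/- (Derivative bound for normalized first-return maps.) Let T : ℝ → ℝ, let m ≥ 1, and let J = [u, v] with u < v; for 0 ≤ i ≤ m−1 set J_i = T^[i] '' J. Assume: (i) the sets J_0, …, J_{m−1} are pairwise disjoint subsets of [0,1]; (ii) at every point of each J_i, T is differentiable with deriv T > 0, and log ∘ (deriv T) is differentiable there with derivative η_T; (iii) |η_T| is integrable on [0,1], and set V = ∫₀¹ |η_T(t)| dt. Then T^[m] restricted to J is a strictly increasing bijection onto the compact interval T^[m] '' J, and its normalization g = N(T^[m]|_J) : [0,1] → [0,1] satisfies exp(−V) ≤ deriv g z ≤ exp(V) for every z ∈ [0,1]. -/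
/-- The normalization `N(f)` of a map `f` sending `[a₁,a₂]` onto `[b₁,b₂]`: the map `f`
pre-composed with the increasing affine map sending `[0,1]` onto `[a₁,a₂]` and
post-composed with the increasing affine map sending `[b₁,b₂]` onto `[0,1]`. -/
noncomputable def normalization (f : ℝ → ℝ) (a₁ a₂ b₁ b₂ : ℝ) : ℝ → ℝ :=
  fun x => (f (a₁ + (a₂ - a₁) * x) - b₁) / (b₂ - b₁)

open MeasureTheory Set in
/-- If `L` has derivative `η` on an order-connected measurable set `S` and `|η|` is integrable
on `S`, then the oscillation of `L` on `S` is at most `∫ |η|` over `S`. -/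
theorem abs_sub_le_setIntegral_abs_of_hasDerivAt {L η : ℝ → ℝ} {S : Set ℝ}
    (hS : S.OrdConnected) (hSm : MeasurableSet S)
    (hL : ∀ z ∈ S, HasDerivAt L (η z) z) (hint : IntegrableOn (fun t => |η t|) S)
    {a b : ℝ} (ha : a ∈ S) (hb : b ∈ S) :
    |L b - L a| ≤ ∫ t in S, |η t| := by
  have hη : IntegrableOn η S := by
    have hmeas : AEStronglyMeasurable η (volume.restrict S) := by
      refine (aestronglyMeasurable_deriv L _).congr ?_
      filter_upwards [ae_restrict_mem hSm] with z hz
      exact (hL z hz).deriv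
    exact (integrable_norm_iff hmeas).1 hint
  have hsub : uIcc a b ⊆ S := hS.uIcc_subset ha hb
  have hFTC : ∫ t in a..b, η t = L b - L a :=
    intervalIntegral.integral_eq_sub_of_hasDerivAt (fun z hz => hL z (hsub hz))
      (hη.mono_set hsub).intervalIntegrable
  rw [← hFTC]
  calc |∫ t in a..b, η t| ≤ ∫ t in uIoc a b, |η t| :=
        intervalIntegral.norm_integral_le_integral_norm_uIoc (f := η)
    _ ≤ ∫ t in S, |η t| :=
        setIntegral_mono_set hint (ae_of_all _ fun _ => abs_nonneg _)
          (uIoc_subset_uIcc.trans hsub).eventuallyLE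

/-- The chain rule along an orbit. -/
theorem hasDerivAt_iterate_prod {T : ℝ → ℝ} {x : ℝ} {m : ℕ}
    (h : ∀ i < m, DifferentiableAt ℝ T (T^[i] x)) :
    HasDerivAt T^[m] (∏ i ∈ Finset.range m, deriv T (T^[i] x)) x := by
  induction m with
  | zero => simpa using hasDerivAt_id x
  | succ k ih =>
    rw [Function.iterate_succ', Finset.prod_range_succ, mul_comm]
    exact (h k k.lt_succ_self).hasDerivAt.comp x (ih fun i hi => h i (hi.trans k.lt_succ_self))

/-- **Derivative bound for normalized first-return maps.**  Let `J = [u,v]` with iterates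
`J, T(J), …, T^{m-1}(J)` pairwise disjoint subsets of `[0,1]`, on which `T` is
differentiable with positive derivative and `log ∘ (deriv T)` has derivative `η`, with
`|η|` integrable on `[0,1]` and `V = ∫₀¹ |η|`.  Then `T^[m]` is a strictly increasing
bijection from `J` onto the compact interval `T^[m] '' J`, and its normalization
`g : [0,1] → [0,1]` satisfies `exp (-V) ≤ g' ≤ exp V` on `[0,1]`. -/
theorem first_return_derivative_bound
    (T : ℝ → ℝ) (m : ℕ) (hm : 1 ≤ m) (u v : ℝ) (huv : u < v)
    (η : ℝ → ℝ)
    (hsub : ∀ i < m, T^[i] '' Set.Icc u v ⊆ Set.Icc (0 : ℝ) 1)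
    (hdisj : ∀ i < m, ∀ j < m, i ≠ j →
      Disjoint (T^[i] '' Set.Icc u v) (T^[j] '' Set.Icc u v))
    (hder : ∀ i < m, ∀ z ∈ T^[i] '' Set.Icc u v,
      DifferentiableAt ℝ T z ∧ 0 < deriv T z ∧
      HasDerivAt (fun t => Real.log (deriv T t)) (η z) z)
    (hint : MeasureTheory.IntegrableOn (fun t => |η t|) (Set.Icc 0 1)) :
    StrictMonoOn (T^[m]) (Set.Icc u v) ∧
    T^[m] '' Set.Icc u v = Set.Icc (T^[m] u) (T^[m] v) ∧
    ∀ z ∈ Set.Icc (0 : ℝ) 1,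
      Real.exp (-(∫ t in (0:ℝ)..1, |η t|))
          ≤ deriv (normalization (T^[m]) u v (T^[m] u) (T^[m] v)) z ∧
        deriv (normalization (T^[m]) u v (T^[m] u) (T^[m] v)) z
          ≤ Real.exp (∫ t in (0:ℝ)..1, |η t|) := by
  have hpos : ∀ i < m, ∀ x ∈ Set.Icc u v, 0 < deriv T (T^[i] x) := fun i hi x hx =>
    (hder i hi _ (Set.mem_image_of_mem _ hx)).2.1
  have hD : ∀ k ≤ m, ∀ x ∈ Set.Icc u v,
      HasDerivAt T^[k] (∏ i ∈ Finset.range k, deriv T (T^[i] x)) x := fun k hk x hx =>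
    hasDerivAt_iterate_prod fun i hi =>
      (hder i (hi.trans_le hk) _ (Set.mem_image_of_mem _ hx)).1
  have hprod : ∀ x ∈ Set.Icc u v, 0 < ∏ i ∈ Finset.range m, deriv T (T^[i] x) := fun x hx =>
    Finset.prod_pos fun i hi => hpos i (Finset.mem_range.1 hi) x hx
  have hcont : ∀ k ≤ m, ContinuousOn T^[k] (Set.Icc u v) := fun k hk x hx =>
    (hD k hk x hx).continuousAt.continuousWithinAt
  have hmono : StrictMonoOn T^[m] (Set.Icc u v) := by
    refine strictMonoOn_of_deriv_pos (convex_Icc u v) (hcont m le_rfl) fun x hx => ?_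
    rw [(hD m le_rfl x (interior_subset hx)).deriv]
    exact hprod x (interior_subset hx)
  have hmeas : ∀ i < m, MeasurableSet (T^[i] '' Set.Icc u v) := fun i hi =>
    (isCompact_Icc.image_of_continuousOn (hcont i hi.le)).measurableSet
  have hsum : ∑ i ∈ Finset.range m, ∫ t in T^[i] '' Set.Icc u v, |η t|
      ≤ ∫ t in (0:ℝ)..1, |η t| := by
    rw [intervalIntegral.integral_of_le zero_le_one, ← MeasureTheory.integral_Icc_eq_integral_Ioc,
      ← MeasureTheory.integral_biUnion_finset (Finset.range m)
        (fun i hi => hmeas i (Finset.mem_range.1 hi))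
        (fun i hi j hj hij => hdisj i (Finset.mem_range.1 hi) j (Finset.mem_range.1 hj) hij)
        (fun i hi => hint.mono_set (hsub i (Finset.mem_range.1 hi)))]
    refine MeasureTheory.setIntegral_mono_set hint
      (MeasureTheory.ae_of_all _ fun _ => abs_nonneg _) ?_
    exact (Set.iUnion₂_subset fun i hi => hsub i (Finset.mem_range.1 hi)).eventuallyLE
  have hosc : ∀ x ∈ Set.Icc u v, ∀ y ∈ Set.Icc u v,
      |Real.log (∏ i ∈ Finset.range m, deriv T (T^[i] x))
        - Real.log (∏ i ∈ Finset.range m, deriv T (T^[i] y))| ≤ ∫ t in (0:ℝ)..1, |η t| := by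
    intro x hx y hy
    rw [Real.log_prod fun i hi => (hpos i (Finset.mem_range.1 hi) x hx).ne',
      Real.log_prod fun i hi => (hpos i (Finset.mem_range.1 hi) y hy).ne',
      ← Finset.sum_sub_distrib]
    refine (Finset.abs_sum_le_sum_abs _ _).trans (le_trans (Finset.sum_le_sum ?_) hsum)
    intro i hi
    have hi := Finset.mem_range.1 hi
    exact abs_sub_le_setIntegral_abs_of_hasDerivAt (L := fun t => Real.log (deriv T t))
      (isPreconnected_Icc.image _ (hcont i hi.le)).ordConnected (hmeas i hi)
      (fun z hz => (hder i hi z hz).2.2) (hint.mono_set (hsub i hi))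
      (Set.mem_image_of_mem _ hy) (Set.mem_image_of_mem _ hx)
  have hu : u ∈ Set.Icc u v := Set.left_mem_Icc.2 huv.le
  have hv : v ∈ Set.Icc u v := Set.right_mem_Icc.2 huv.le
  refine ⟨hmono, ?_, fun z hz => ?_⟩
  · refine Set.Subset.antisymm ?_ (intermediate_value_Icc huv.le (hcont m le_rfl))
    rintro _ ⟨x, hx, rfl⟩
    exact ⟨hmono.monotoneOn hu hx hx.1, hmono.monotoneOn hx hv hx.2⟩
  obtain ⟨c, hc, hslope⟩ := exists_hasDerivAt_eq_slope T^[m] _ huv (hcont m le_rfl)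
    fun x hx => hD m le_rfl x (Set.Ioo_subset_Icc_self hx)
  have hcI := Set.Ioo_subset_Icc_self hc
  have hxI : u + (v - u) * z ∈ Set.Icc u v :=
    ⟨by nlinarith [hz.1], by nlinarith [hz.2]⟩
  have hg : HasDerivAt (normalization T^[m] u v (T^[m] u) (T^[m] v))
      ((∏ i ∈ Finset.range m, deriv T (T^[i] (u + (v - u) * z))) * (v - u)
        / (T^[m] v - T^[m] u)) z := by
    have haff : HasDerivAt (fun x : ℝ => u + (v - u) * x) (v - u) z := by
      simpa using ((hasDerivAt_id z).const_mul (v - u)).const_add u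
    exact (((hD m le_rfl _ hxI).comp z haff).sub_const _).div_const _
  have hratio : (∏ i ∈ Finset.range m, deriv T (T^[i] (u + (v - u) * z))) * (v - u)
        / (T^[m] v - T^[m] u)
      = Real.exp (Real.log (∏ i ∈ Finset.range m, deriv T (T^[i] (u + (v - u) * z)))
        - Real.log (∏ i ∈ Finset.range m, deriv T (T^[i] c))) := by
    rw [Real.exp_sub, Real.exp_log (hprod _ hxI), Real.exp_log (hprod c hcI), hslope,
      div_div_eq_mul_div]
  rw [hg.deriv, hratio, Real.exp_le_exp, Real.exp_le_exp]
  exact abs_le.1 (hosc _ hxI c hcI)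
end

section
/- (Denjoy–Koksma inequality applied to the logarithm of the derivative.) Let F : ℝ → ℝ be a continuous, strictly increasing map with F(x+1) = F(x) + 1 for all x, inducing a homeomorphism T of the circle ℝ/ℤ whose rotation number α ∈ (0,1) is irrational. Assume there is a finite set B ⊂ [0,1) such that F is differentiable with deriv F > 0 at every point of ℝ ∖ (B + ℤ), and that the function ψ : ℝ/ℤ → ℝ induced by log ∘ (deriv F) (defined off the finite set B mod 1) has bounded variation with total variation V. Let μ be a T-invariant Borel probability measure on ℝ/ℤ and let q be a convergent denominator of α. Then for every x ∈ ℝ such that (F^[i] x mod 1) ∉ (B mod 1) for all 0 ≤ i ≤ q−1, one has |∑_{i=0}^{q−1} log (deriv F (F^[i] x)) − q · ∫ ψ dμ| ≤ V; equivalently, since deriv (F^[q]) x = ∏_{i=0}^{q−1} deriv F (F^[i] x), one has |log (deriv (F^[q]) x) − q · ∫ ψ dμ| ≤ V. -/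
open MeasureTheory Set

theorem exists_variation_majorant_of_periodic {f : ℝ → ℝ} (hf : Function.Periodic f 1) {V : ℝ}
    (hV : 0 ≤ V) (hBV : eVariationOn f (Icc 0 1) = ENNReal.ofReal V) :
    ∃ W : ℝ → ℝ, (∀ a b, a ≤ b → |f b - f a| ≤ W b - W a) ∧ ∀ a, W (a + 1) = W a + V := by
  set v : ℝ → ℝ := fun t => (eVariationOn f (Icc 0 t)).toReal with hv
  have hfin : ∀ {s : Set ℝ}, s ⊆ Icc 0 1 → eVariationOn f s ≠ ⊤ := fun {s} hs =>
    ne_top_of_le_ne_top (by rw [hBV]; exact ENNReal.ofReal_ne_top) (eVariationOn.mono f hs)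
  have hdist : ∀ {s t : ℝ}, 0 ≤ s → s ≤ t → t ≤ 1 → |f t - f s| ≤ v t - v s := by
    intro s t h0 hst h1
    have hst' : Icc s t ⊆ Icc 0 1 := Icc_subset_Icc h0 h1
    have hadd := eVariationOn.Icc_add_Icc f (s := univ) h0 hst (mem_univ s)
    simp only [univ_inter] at hadd
    have hvt : v t = v s + (eVariationOn f (Icc s t)).toReal := by
      rw [hv]
      simp only
      rw [← hadd, ENNReal.toReal_add (hfin (Icc_subset_Icc le_rfl (hst.trans h1))) (hfin hst')]
    have h := BoundedVariationOn.dist_le (f := f) (s := Icc s t) (hfin hst')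
      (right_mem_Icc.2 hst) (left_mem_Icc.2 hst)
    rw [Real.dist_eq] at h
    linarith
  have hv0 : v 0 = 0 := by simp [hv, eVariationOn.subsingleton]
  have hv1 : v 1 = V := by simp [hv, hBV, hV]
  have hfr : ∀ a, f (Int.fract a) = f a := fun a => by
    rw [← Int.self_sub_floor]
    simpa using hf.sub_int_mul_eq ⌊a⌋ (x := a)
  refine ⟨fun y => ⌊y⌋ * V + v (Int.fract y), fun a b hab => ?_, fun a => ?_⟩
  · have ha0 := Int.fract_nonneg a
    have hb0 := Int.fract_nonneg b
    have ha1 := (Int.fract_lt_one a).le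
    have hb1 := (Int.fract_lt_one b).le
    rw [← hfr a, ← hfr b]
    beta_reduce
    rcases (Int.floor_mono hab).eq_or_lt with h | h
    · have hfab : Int.fract a ≤ Int.fract b := by
        rw [← Int.self_sub_floor, ← Int.self_sub_floor, h]; linarith
      have := hdist ha0 hfab hb1
      rw [h]; linarith
    · have h1 := hdist ha0 ha1 le_rfl
      have h2 := hdist le_rfl hb0 hb1
      have h01 : f 1 = f 0 := by simpa using hf 0
      rw [hv1, h01] at h1
      rw [hv0] at h2
      have h3 : (⌊a⌋ : ℝ) + 1 ≤ ⌊b⌋ := by exact_mod_cast h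
      have h4 := abs_sub_le (f (Int.fract b)) (f 0) (f (Int.fract a))
      nlinarith
  · simp only [Int.floor_add_one, Int.fract_add_one]
    push_cast
    ring

theorem sum_range_mul_emod_of_isCoprime {M : Type*} [AddCommMonoid M] {p : ℤ} {q : ℕ}
    (hq : 0 < q) (hpq : IsCoprime p (q : ℤ)) (G : ℕ → M) :
    ∑ i ∈ Finset.range q, G ((i * p) % q).toNat = ∑ j ∈ Finset.range q, G j := by
  have hq' : (0 : ℤ) < q := by exact_mod_cast hq
  have hmaps : ∀ i ∈ Finset.range q, ((i * p) % q : ℤ).toNat ∈ Finset.range q := fun i _ => by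
    have := Int.emod_lt_of_pos (i * p) hq'
    have := Int.emod_nonneg (i * p) hq'.ne'
    rw [Finset.mem_range]; omega
  have hinj : Set.InjOn (fun i : ℕ => ((i * p) % q : ℤ).toNat) (Finset.range q) := by
    intro i hi j hj hij
    simp only [Finset.coe_range, mem_Iio] at hi hj
    have h1 := Int.emod_nonneg (i * p) hq'.ne'
    have h2 := Int.emod_nonneg (j * p) hq'.ne'
    simp only at hij
    have h3 : (i * p : ℤ) ≡ j * p [ZMOD q] := by
      unfold Int.ModEq; omega
    have h4 : (q : ℤ) ∣ (j - i) * p := by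
      rw [sub_mul]; exact h3.dvd
    have h5 : (q : ℤ) ∣ j - i := hpq.symm.dvd_of_dvd_mul_right h4
    have h6 := Int.eq_zero_of_abs_lt_dvd h5 (by rw [abs_lt]; constructor <;> omega)
    omega
  exact Finset.sum_nbij (fun i : ℕ => ((i * p) % q : ℤ).toNat) hmaps hinj
    (Finset.surjOn_of_injOn_of_card_le _ hmaps hinj le_rfl) fun _ _ => rfl

namespace GenContFract

theorem exists_int_contsAux_of (v : ℝ) (n : ℕ) :
    ∃ a b : ℤ, (GenContFract.of v).contsAux n = ⟨a, b⟩ := by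
  induction n using Nat.strong_induction_on with
  | _ n ih =>
    match n with
    | 0 => exact ⟨1, 0, by simp [contsAux]⟩
    | 1 => exact ⟨⌊v⌋, 1, by simp [contsAux, of_h_eq_floor]⟩
    | n + 2 =>
      obtain ⟨a, b, hab⟩ := ih n (by omega)
      obtain ⟨c, d, hcd⟩ := ih (n + 1) (by omega)
      rcases hs : (GenContFract.of v).s.get? n with _ | gp
      · exact ⟨c, d, by rw [contsAux_stable_step_of_terminated hs, hcd]⟩
      · obtain ⟨h1, z, hz⟩ := of_partNum_eq_one_and_exists_int_partDen_eq hs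
        refine ⟨z * c + a, z * d + b, ?_⟩
        rw [contsAux_recurrence hs hab hcd, h1, hz]
        simp

theorem exists_isCoprime_abs_sub_div_le {α : ℝ} (hα : Irrational α) {q : ℕ} (hq : 1 ≤ q)
    {n : ℕ} (hn : (q : ℝ) = (GenContFract.of α).dens n) :
    ∃ p : ℤ, IsCoprime p (q : ℤ) ∧ |α - p / q| ≤ 1 / (q : ℝ) ^ 2 := by
  have hterm : ∀ m, ¬ (GenContFract.of α).TerminatedAt m := fun m hm => by
    obtain ⟨r, hr⟩ := (terminates_iff_rat α).1 ⟨m, hm⟩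
    exact hα ⟨r, hr.symm⟩
  obtain ⟨p, d, hpd⟩ := exists_int_contsAux_of α (n + 1)
  obtain ⟨p', d', hpd'⟩ := exists_int_contsAux_of α (n + 2)
  have hnum : (GenContFract.of α).nums n = p := by rw [num_eq_conts_a, nth_cont_eq_succ_nth_contAux, hpd]
  have hden : (GenContFract.of α).dens n = d := by rw [den_eq_conts_b, nth_cont_eq_succ_nth_contAux, hpd]
  have hnum' : (GenContFract.of α).nums (n + 1) = p' := by
    rw [num_eq_conts_a, nth_cont_eq_succ_nth_contAux, hpd']
  have hden' : (GenContFract.of α).dens (n + 1) = d' := by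
    rw [den_eq_conts_b, nth_cont_eq_succ_nth_contAux, hpd']
  have hqd : (q : ℤ) = d := by rw [hden] at hn; exact_mod_cast hn
  have hq0 : (0 : ℝ) < q := by exact_mod_cast hq
  refine ⟨p, ?_, ?_⟩
  · have hdet := SimpContFract.determinant (s := SimpContFract.of α) (n := n) (hterm n)
    change (GenContFract.of α).nums n * (GenContFract.of α).dens (n + 1) -
      (GenContFract.of α).dens n * (GenContFract.of α).nums (n + 1) = _ at hdet
    rw [hnum, hden, hnum', hden'] at hdet
    have hdet' : p * d' - d * p' = (-1 : ℤ) ^ (n + 1) := by exact_mod_cast hdet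
    rw [hqd]
    refine ⟨(-1) ^ (n + 1) * d', -(-1) ^ (n + 1) * p', ?_⟩
    have : ((-1 : ℤ) ^ (n + 1)) * (-1) ^ (n + 1) = 1 := by
      rw [← mul_pow]; simp
    linear_combination ((-1 : ℤ) ^ (n + 1)) * hdet' + this
  · have h := abs_sub_convs_le (hterm n)
    have hmono : (GenContFract.of α).dens n ≤ (GenContFract.of α).dens (n + 1) := of_den_mono
    rw [conv_eq_num_div_den, hnum, ← hn] at h
    rw [← hn] at hmono
    refine h.trans ?_
    rw [sq]
    gcongr

end GenContFract

/-- The representative in `[0, 1)` of a point of the circle. -/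
noncomputable def unitRep (z : AddCircle (1 : ℝ)) : ℝ := AddCircle.equivIco 1 0 z

theorem coe_unitRep (z : AddCircle (1 : ℝ)) : (unitRep z : AddCircle (1 : ℝ)) = z :=
  AddCircle.coe_equivIco

theorem unitRep_mem (z : AddCircle (1 : ℝ)) : unitRep z ∈ Ico (0 : ℝ) 1 := by
  have h : unitRep z ∈ Ico (0 : ℝ) (0 + 1) := (AddCircle.equivIco (1 : ℝ) 0 z).2
  rwa [zero_add] at h

theorem measurable_unitRep : Measurable unitRep :=
  measurable_subtype_coe.comp (AddCircle.measurableEquivIco (1 : ℝ) 0).measurable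

theorem coe_eq_coe_iff_exists_int {x y : ℝ} :
    (x : AddCircle (1 : ℝ)) = y ↔ ∃ m : ℤ, x = y + m := by
  rw [← sub_eq_zero, ← AddCircle.coe_sub, AddCircle.coe_eq_zero_iff]
  refine exists_congr fun m => ?_
  rw [zsmul_eq_mul, mul_one, eq_comm, sub_eq_iff_eq_add']

theorem coe_add_int (x : ℝ) (m : ℤ) : ((x + m : ℝ) : AddCircle (1 : ℝ)) = x :=
  coe_eq_coe_iff_exists_int.2 ⟨m, rfl⟩

/-- The lift to the line of the distribution function of a measure on the circle: its increment
over `(a, b]` integrates the number of lifts of a point lying in `(a, b]`. -/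
noncomputable def liftedCdf (μ : Measure (AddCircle (1 : ℝ))) (y : ℝ) : ℝ :=
  ∫ z, (⌊y - unitRep z⌋ : ℝ) ∂μ

theorem measurable_floor_sub_unitRep (y : ℝ) :
    Measurable fun z : AddCircle (1 : ℝ) => (⌊y - unitRep z⌋ : ℝ) :=
  (measurable_from_top (f := fun n : ℤ => (n : ℝ))).comp
    (Int.measurable_floor.comp (measurable_const.sub measurable_unitRep))

theorem abs_floor_sub_unitRep_le (y : ℝ) (z : AddCircle (1 : ℝ)) :
    |(⌊y - unitRep z⌋ : ℝ)| ≤ |y| + 2 := by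
  have h := unitRep_mem z
  have h1 := Int.floor_le (y - unitRep z)
  have h2 := Int.lt_floor_add_one (y - unitRep z)
  rw [abs_le]
  constructor <;> linarith [h.1, h.2, neg_abs_le y, le_abs_self y]

section

variable (μ : Measure (AddCircle (1 : ℝ))) [IsProbabilityMeasure μ]

theorem integrable_floor_sub_unitRep (y : ℝ) :
    Integrable (fun z : AddCircle (1 : ℝ) => (⌊y - unitRep z⌋ : ℝ)) μ :=
  .of_bound (measurable_floor_sub_unitRep y).aestronglyMeasurable (|y| + 2)
    (.of_forall (abs_floor_sub_unitRep_le y))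

theorem liftedCdf_monotone : Monotone (liftedCdf μ) := fun a b hab =>
  integral_mono (integrable_floor_sub_unitRep μ a) (integrable_floor_sub_unitRep μ b) fun _ =>
    Int.cast_le.2 (Int.floor_mono (sub_le_sub_right hab _))

theorem liftedCdf_add_int (y : ℝ) (m : ℤ) : liftedCdf μ (y + m) = liftedCdf μ y + m := by
  have h : ∀ z : AddCircle (1 : ℝ), (⌊y + m - unitRep z⌋ : ℝ) = ⌊y - unitRep z⌋ + m := fun z => by
    rw [add_sub_right_comm, Int.floor_add_intCast]; push_cast; rfl
  simp_rw [liftedCdf, h]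
  rw [integral_add (integrable_floor_sub_unitRep μ y) (integrable_const _)]
  simp

theorem liftedCdf_continuous [NullSingletonClass μ] : Continuous (liftedCdf μ) := by
  refine continuous_iff_continuousAt.2 fun y => ?_
  refine continuousAt_of_dominated (bound := fun _ => |y| + 3)
    (.of_forall fun t => (measurable_floor_sub_unitRep t).aestronglyMeasurable) ?_
    (integrable_const _) ?_
  · filter_upwards [Metric.ball_mem_nhds y one_pos] with t ht
    refine .of_forall fun z => (abs_floor_sub_unitRep_le t z).trans ?_
    rw [Metric.mem_ball, Real.dist_eq] at ht
    have := abs_sub_abs_le_abs_sub t y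
    linarith
  · have hne : ∀ᵐ z ∂μ, z ≠ (y : AddCircle (1 : ℝ)) := by
      simp [ae_iff]
    filter_upwards [hne] with z hz
    have hlt : (⌊y - unitRep z⌋ : ℝ) < y - unitRep z := by
      refine (Int.floor_le _).lt_of_ne fun h => hz ?_
      rw [← coe_unitRep z, eq_comm, coe_eq_coe_iff_exists_int]
      exact ⟨⌊y - unitRep z⌋, by rw [h]; ring⟩
    have hmem : Ico (⌊y - unitRep z⌋ : ℝ) (⌊y - unitRep z⌋ + 1) ∈ nhds (y - unitRep z) :=
      Ico_mem_nhds hlt (Int.lt_floor_add_one _)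
    exact ((continuousOn_floor _).continuousAt hmem).comp
      (f := fun t => t - unitRep z) (by fun_prop)

end

namespace CircleDeg1Lift

variable {F : CircleDeg1Lift} {T : AddCircle (1 : ℝ) → AddCircle (1 : ℝ)}
  {μ : Measure (AddCircle (1 : ℝ))} [IsProbabilityMeasure μ]

theorem floor_map_sub_map (hF : StrictMono F) (x y : ℝ) : ⌊F x - F y⌋ = ⌊x - y⌋ := by
  rw [Int.floor_eq_iff]
  have h1 := Int.floor_le (x - y)
  have h2 := Int.lt_floor_add_one (x - y)
  have h3 : F (y + ⌊x - y⌋) ≤ F x := F.monotone (by linarith)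
  have h4 : F x < F (y + (⌊x - y⌋ + 1 : ℤ)) := hF (by push_cast; linarith)
  rw [map_add_int] at h3 h4
  push_cast at h4
  constructor <;> linarith

theorem liftedCdf_map (hF : StrictMono F) (hT : ∀ x : ℝ, T x = (F x : ℝ))
    (hμ : MeasurePreserving T μ μ) (y : ℝ) :
    liftedCdf μ (F y) = liftedCdf μ y + F.translationNumber := by
  have hm : ∀ z, ∃ m : ℤ, unitRep (T z) = F (unitRep z) + m := fun z => by
    rw [← coe_eq_coe_iff_exists_int, coe_unitRep, ← hT, coe_unitRep]
  choose m hm using hm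
  have hfl : ∀ y z, (⌊F y - unitRep (T z)⌋ : ℝ) = ⌊y - unitRep z⌋ - m z := fun y z => by
    rw [hm, ← sub_sub, Int.floor_sub_intCast, floor_map_sub_map hF]
    push_cast; rfl
  have hintT : ∀ y, Integrable (fun z => (⌊F y - unitRep (T z)⌋ : ℝ)) μ := fun y =>
    hμ.integrable_comp_of_integrable (integrable_floor_sub_unitRep μ (F y))
  have hint : Integrable (fun z => (m z : ℝ)) μ := by
    refine ((integrable_floor_sub_unitRep μ 0).sub (hintT 0)).congr (.of_forall fun z => ?_)
    simp [hfl]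
  have hsemi : ∀ y, liftedCdf μ (F y) = -(∫ z, (m z : ℝ) ∂μ) + liftedCdf μ y := fun y => by
    have : liftedCdf μ (F y) = ∫ z, (⌊F y - unitRep (T z)⌋ : ℝ) ∂μ := by
      rw [liftedCdf]
      conv_lhs => rw [← hμ.map_eq]
      exact integral_map hμ.measurable.aemeasurable
        (measurable_floor_sub_unitRep (F y)).aestronglyMeasurable
    rw [this]
    simp_rw [hfl]
    rw [integral_sub (integrable_floor_sub_unitRep μ y) hint, liftedCdf]
    ring
  let H : CircleDeg1Lift :=
    ⟨⟨liftedCdf μ, liftedCdf_monotone μ⟩, fun y => by simpa using liftedCdf_add_int μ y 1⟩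
  have hτ : F.translationNumber = -∫ z, (m z : ℝ) ∂μ := by
    rw [← translationNumber_translate (-∫ z, (m z : ℝ) ∂μ)]
    exact translationNumber_eq_of_semiconj (f := H) hsemi
  rw [hτ, hsemi, add_comm]

theorem liftedCdf_iterate (hF : StrictMono F) (hT : ∀ x : ℝ, T x = (F x : ℝ))
    (hμ : MeasurePreserving T μ μ) (n : ℕ) (y : ℝ) :
    liftedCdf μ (F^[n] y) = liftedCdf μ y + n * F.translationNumber := by
  induction n with
  | zero => simp
  | succ n ih =>
    rw [Function.iterate_succ_apply', liftedCdf_map hF hT hμ, ih]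
    push_cast; ring

theorem coe_iterate (hT : ∀ x : ℝ, T x = (F x : ℝ)) (n : ℕ) (y : ℝ) :
    T^[n] y = (F^[n] y : ℝ) := by
  induction n with
  | zero => rfl
  | succ n ih => rw [Function.iterate_succ_apply', ih, hT, Function.iterate_succ_apply']

theorem nullSingletonClass_of_irrational_translationNumber (hF : StrictMono F)
    (hT : ∀ x : ℝ, T x = (F x : ℝ)) (hμ : MeasurePreserving T μ μ)
    (hirr : Irrational F.translationNumber) : NullSingletonClass μ := by
  have hTinj : Function.Injective T := fun z w h => by
    rw [← coe_unitRep z, ← coe_unitRep w, hT, hT, coe_eq_coe_iff_exists_int] at h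
    obtain ⟨m, hm⟩ := h
    rw [← map_add_int] at hm
    rw [← coe_unitRep z, ← coe_unitRep w]
    exact coe_eq_coe_iff_exists_int.2 ⟨m, hF.injective hm⟩
  refine ⟨fun z => by_contra fun hz => ?_⟩
  have hmeas : ∀ n, μ {T^[n] z} = μ {z} := fun n => by
    rw [← (hμ.iterate n).measure_preimage (measurableSet_singleton _).nullMeasurableSet]
    congr 1
    ext w
    simp [(hTinj.iterate n).eq_iff]
  have hinj : Function.Injective fun n => T^[n] z := fun n k h => by
    simp only at h
    rw [← coe_unitRep z, coe_iterate hT, coe_iterate hT, coe_eq_coe_iff_exists_int] at h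
    obtain ⟨m, hm⟩ := h
    have h1 := congrArg (liftedCdf μ) hm
    rw [liftedCdf_add_int, liftedCdf_iterate hF hT hμ, liftedCdf_iterate hF hT hμ] at h1
    by_contra hnk
    have h2 : (n : ℤ) - k ≠ 0 := by omega
    refine (hirr.intCast_mul h2).ne_int m ?_
    push_cast
    linarith
  have htop := (infinite_range_of_injective hinj).meas_eq_top (μ := μ)
    ⟨μ {z}, hz, by rintro _ ⟨n, rfl⟩; exact (hmeas n).ge⟩
  exact measure_ne_top μ _ htop

end CircleDeg1Lift

theorem exists_shift_forall_mul_mem {δ : ℝ} {q : ℕ} (hq : 0 < q) (hδ : |δ| ≤ 1 / (q : ℝ) ^ 2) :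
    ∃ s : ℝ, ∀ i < q, s < i * δ ∧ i * δ < s + 1 / q := by
  have hq0 : (0 : ℝ) < q := by exact_mod_cast hq
  set u : ℝ := 1 / (q : ℝ) ^ 2 with hu
  have hu0 : 0 < u := by positivity
  have hqu : 1 / (q : ℝ) = q * u := by rw [hu]; field_simp
  have hbound : ∀ i < q, i * |δ| ≤ q * u - u := fun i hi => by
    have h1 : (i : ℝ) + 1 ≤ q := by exact_mod_cast hi
    calc i * |δ| ≤ i * u := by gcongr
      _ ≤ (q - 1) * u := by gcongr; linarith
      _ = q * u - u := by ring
  rw [hqu]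
  rcases le_total 0 δ with h | h
  · refine ⟨-(u / 2), fun i hi => ?_⟩
    have := hbound i hi
    rw [abs_of_nonneg h] at this
    have : 0 ≤ i * δ := by positivity
    constructor <;> linarith
  · refine ⟨u / 2 - q * u, fun i hi => ?_⟩
    have := hbound i hi
    rw [abs_of_nonpos h] at this
    have : i * δ ≤ 0 := mul_nonpos_of_nonneg_of_nonpos (Nat.cast_nonneg i) h
    constructor <;> linarith

section Majorant

variable {f W : ℝ → ℝ}

theorem monotone_of_abs_sub_le (hW : ∀ a b, a ≤ b → |f b - f a| ≤ W b - W a) : Monotone W :=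
  fun a b hab => sub_nonneg.1 ((abs_nonneg _).trans (hW a b hab))

theorem measurable_of_abs_sub_le (hW : ∀ a b, a ≤ b → |f b - f a| ≤ W b - W a) :
    Measurable f := by
  have hmono : Monotone fun t => W t - f t := fun a b hab => by
    have := (le_abs_self _).trans (hW a b hab)
    simp only
    linarith
  have h : f = fun t => W t - (W t - f t) := by ext; ring
  rw [h]
  exact (monotone_of_abs_sub_le hW).measurable.sub hmono.measurable

theorem abs_sub_le_of_mem_Icc (hW : ∀ a b, a ≤ b → |f b - f a| ≤ W b - W a) {a b s t : ℝ}
    (hs : s ∈ Icc a b) (ht : t ∈ Icc a b) : |f s - f t| ≤ W b - W a := by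
  have hmono := monotone_of_abs_sub_le hW
  wlog hst : t ≤ s generalizing s t
  · rw [abs_sub_comm]
    exact this ht hs (le_of_not_ge hst)
  exact (hW t s hst).trans (sub_le_sub (hmono hs.2) (hmono ht.1))

end Majorant

theorem abs_sub_mul_integral_floor_le {μ : Measure (AddCircle (1 : ℝ))} [IsProbabilityMeasure μ]
    {ψ : AddCircle (1 : ℝ) → ℝ} {W : ℝ → ℝ} (hψ : Integrable ψ μ)
    (hW : ∀ a b, a ≤ b → |ψ (b : ℝ) - ψ (a : ℝ)| ≤ W b - W a) {a b y Q : ℝ} (hab : a ≤ b)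
    (hy : y ∈ Icc a b) (hQ : 0 ≤ Q) (hmass : Q * (liftedCdf μ b - liftedCdf μ a) = 1) :
    Integrable (fun z => ψ z * ((⌊b - unitRep z⌋ : ℝ) - ⌊a - unitRep z⌋)) μ ∧
    |ψ y - Q * ∫ z, ψ z * ((⌊b - unitRep z⌋ : ℝ) - ⌊a - unitRep z⌋) ∂μ| ≤ W b - W a := by
  set N : AddCircle (1 : ℝ) → ℝ := fun z => (⌊b - unitRep z⌋ : ℝ) - ⌊a - unitRep z⌋ with hN
  have hNint : Integrable N μ :=
    (integrable_floor_sub_unitRep μ b).sub (integrable_floor_sub_unitRep μ a)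
  have hNmass : ∫ z, N z ∂μ = liftedCdf μ b - liftedCdf μ a :=
    integral_sub (integrable_floor_sub_unitRep μ b) (integrable_floor_sub_unitRep μ a)
  have hψN : Integrable (fun z => ψ z * N z) μ := by
    refine hψ.mul_bdd (c := |b| + 2 + (|a| + 2))
      ((measurable_floor_sub_unitRep b).sub (measurable_floor_sub_unitRep a)).aestronglyMeasurable
      (.of_forall fun z => ?_)
    exact (abs_sub _ _).trans
      (add_le_add (abs_floor_sub_unitRep_le b z) (abs_floor_sub_unitRep_le a z))
  refine ⟨hψN, ?_⟩
  have hpt : ∀ z, ‖(ψ y - ψ z) * N z‖ ≤ (W b - W a) * N z := fun z => by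
    have hfl : ⌊a - unitRep z⌋ ≤ ⌊b - unitRep z⌋ := Int.floor_mono (by linarith)
    have hN0 : 0 ≤ N z := sub_nonneg.2 (by exact_mod_cast hfl)
    rcases hfl.eq_or_lt with h | h
    · have : N z = 0 := by simp [hN, h]
      simp [this]
    · have h1 : a < unitRep z + ⌊b - unitRep z⌋ := by
        have := Int.floor_lt.1 h
        linarith
      have h2 : unitRep z + ⌊b - unitRep z⌋ ≤ b := by
        have := Int.floor_le (b - unitRep z)
        linarith
      have h3 := abs_sub_le_of_mem_Icc (f := fun t => ψ (t : ℝ)) hW hy ⟨h1.le, h2⟩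
      rw [coe_add_int, coe_unitRep] at h3
      rw [norm_mul, Real.norm_eq_abs, Real.norm_eq_abs, abs_of_nonneg hN0]
      gcongr
  have hint := norm_integral_le_of_norm_le (hNint.const_mul (W b - W a)) (.of_forall hpt)
  rw [integral_const_mul, hNmass] at hint
  simp_rw [sub_mul] at hint
  rw [integral_sub (hNint.const_mul _) hψN, integral_const_mul, hNmass, Real.norm_eq_abs] at hint
  calc |ψ y - Q * ∫ z, ψ z * N z ∂μ|
      = Q * |ψ y * (liftedCdf μ b - liftedCdf μ a) - ∫ z, ψ z * N z ∂μ| := by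
        rw [← abs_of_nonneg hQ, ← abs_mul, abs_of_nonneg hQ]
        congr 1
        linear_combination (-ψ y) * hmass
    _ ≤ Q * (W b * (liftedCdf μ b - liftedCdf μ a) - W a * (liftedCdf μ b - liftedCdf μ a)) := by
        gcongr
    _ = W b - W a := by linear_combination (W b - W a) * hmass

/-- The **Denjoy–Koksma inequality** for a function of bounded variation on the circle. -/
theorem CircleDeg1Lift.denjoy_koksma {F : CircleDeg1Lift}
    {T : AddCircle (1 : ℝ) → AddCircle (1 : ℝ)} {μ : Measure (AddCircle (1 : ℝ))}
    [IsProbabilityMeasure μ] (hF : StrictMono F)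
    (hT : ∀ x : ℝ, T x = (F x : ℝ)) (hμ : MeasurePreserving T μ μ)
    (hirr : Irrational F.translationNumber) {p : ℤ} {q : ℕ} (hq : 0 < q)
    (hpq : IsCoprime p (q : ℤ)) (happrox : |F.translationNumber - p / q| ≤ 1 / (q : ℝ) ^ 2)
    {ψ : AddCircle (1 : ℝ) → ℝ} {V : ℝ} (hV : 0 ≤ V)
    (hBV : eVariationOn (fun t : ℝ => ψ (t : AddCircle (1 : ℝ))) (Icc 0 1) = ENNReal.ofReal V)
    (x : ℝ) :
    |∑ i ∈ Finset.range q, ψ (F^[i] x : ℝ) - q * ∫ z, ψ z ∂μ| ≤ V := by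
  have := nullSingletonClass_of_irrational_translationNumber hF hT hμ hirr
  have hq0 : (0 : ℝ) < q := by exact_mod_cast hq
  have hqZ : (0 : ℤ) < q := by exact_mod_cast hq
  have hper : Function.Periodic (fun t : ℝ => ψ (t : AddCircle (1 : ℝ))) 1 := fun t => by
    simp
  obtain ⟨W, hW, hW1⟩ := exists_variation_majorant_of_periodic hper hV hBV
  have hψint : Integrable ψ μ := by
    have hmeas : Measurable ψ := by
      have h : ψ = (fun t : ℝ => ψ (t : AddCircle (1 : ℝ))) ∘ unitRep := by
        ext z; simp [coe_unitRep]
      rw [h]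
      exact (measurable_of_abs_sub_le hW).comp measurable_unitRep
    refine .of_bound hmeas.aestronglyMeasurable (|ψ (0 : ℝ)| + V) (.of_forall fun z => ?_)
    have h := abs_sub_le_of_mem_Icc hW (Ico_subset_Icc_self (unitRep_mem z))
      (left_mem_Icc.2 zero_le_one)
    rw [coe_unitRep] at h
    have h1 : W 1 = W 0 + V := by simpa using hW1 0
    rw [Real.norm_eq_abs]
    have := abs_sub_abs_le_abs_sub (ψ z) (ψ (0 : ℝ))
    linarith
  have hsurj : ∀ t, ∃ y, liftedCdf μ y = t := fun t => by
    refine mem_range_of_exists_le_of_exists_ge (liftedCdf_continuous μ)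
      ⟨0 + ⌊t - liftedCdf μ 0⌋, ?_⟩ ⟨0 + ⌈t - liftedCdf μ 0⌉, ?_⟩
    · rw [liftedCdf_add_int]; linarith [Int.floor_le (t - liftedCdf μ 0)]
    · rw [liftedCdf_add_int]; linarith [Int.le_ceil (t - liftedCdf μ 0)]
  obtain ⟨s, hs⟩ := exists_shift_forall_mul_mem hq happrox
  choose g hg using fun k : ℕ => hsurj (liftedCdf μ x + s + k / q)
  set a : ℕ → ℝ := fun n => g (n % q) + ((n / q : ℕ) : ℤ) with ha
  have hha : ∀ n, liftedCdf μ (a n) = liftedCdf μ x + s + n / q := fun n => by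
    have h : (q : ℝ) * (n / q : ℕ) + (n % q : ℕ) = n := by exact_mod_cast Nat.div_add_mod n q
    rw [ha]
    simp only
    rw [liftedCdf_add_int, hg, Int.cast_natCast, ← h]
    field_simp
    ring
  have haq : a q = a 0 + 1 := by simp [ha, hq.ne']
  have hlt_of_liftedCdf : ∀ {s t}, liftedCdf μ s < liftedCdf μ t → s < t :=
    fun h => (liftedCdf_monotone μ).reflect_lt h
  have hastep : ∀ n, a n ≤ a (n + 1) := fun n => by
    refine (hlt_of_liftedCdf ?_).le
    rw [hha, hha]
    gcongr
    simp
  set N : ℕ → AddCircle (1 : ℝ) → ℝ :=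
    fun j z => (⌊a (j + 1) - unitRep z⌋ : ℝ) - ⌊a j - unitRep z⌋ with hN
  have hNsum : ∀ z, ∑ j ∈ Finset.range q, N j z = 1 := fun z => by
    rw [hN]
    simp only
    rw [Finset.sum_range_sub fun j => (⌊a j - unitRep z⌋ : ℝ), haq, add_sub_right_comm,
      Int.floor_add_one]
    push_cast; ring
  have hmass : ∀ j, (q : ℝ) * (liftedCdf μ (a (j + 1)) - liftedCdf μ (a j)) = 1 := fun j => by
    rw [hha, hha]
    push_cast
    field_simp
    ring
  have hintegral : ∫ z, ψ z ∂μ = ∑ j ∈ Finset.range q, ∫ z, ψ z * N j z ∂μ := by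
    have hint : ∀ j, Integrable (fun z => ψ z * N j z) μ := fun j =>
      (abs_sub_mul_integral_floor_le hψint hW (hastep j) (left_mem_Icc.2 (hastep j)) hq0.le
        (hmass j)).1
    rw [← integral_finsetSum _ fun j _ => hint j]
    simp_rw [← Finset.mul_sum, hNsum, mul_one]
  set J : ℕ → ℕ := fun i => ((i * p) % q : ℤ).toNat with hJ
  have hterm : ∀ i ∈ Finset.range q,
      |ψ (F^[i] x : ℝ) - q * ∫ z, ψ z * N (J i) z ∂μ| ≤ W (a (J i + 1)) - W (a (J i)) := by
    intro i hi
    set y : ℝ := F^[i] x + (-((i * p) / q) : ℤ) with hy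
    have hψy : ψ (F^[i] x : ℝ) = ψ (y : ℝ) := by rw [hy, coe_add_int]
    have hJi : ((J i : ℤ) : ℝ) = i * p - q * ((i * p / q : ℤ) : ℝ) := by
      have h1 : (J i : ℤ) = i * p % q := Int.toNat_of_nonneg (Int.emod_nonneg _ hqZ.ne')
      rw [h1, Int.emod_def]
      push_cast; ring
    have hhy : liftedCdf μ y =
        liftedCdf μ x + i * (F.translationNumber - p / q) + (J i : ℝ) / q := by
      rw [hy, liftedCdf_add_int, liftedCdf_iterate hF hT hμ]
      rw [Int.cast_natCast] at hJi
      rw [hJi]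
      push_cast
      field_simp
      ring
    obtain ⟨hs1, hs2⟩ := hs i (Finset.mem_range.1 hi)
    rw [hψy]
    refine (abs_sub_mul_integral_floor_le hψint hW (hastep _) ⟨(hlt_of_liftedCdf ?_).le,
      (hlt_of_liftedCdf ?_).le⟩ hq0.le (hmass _)).2
    · rw [hha, hhy]; linarith
    · rw [hha, hhy]; push_cast; rw [add_div]; linarith
  rw [hintegral, ← sum_range_mul_emod_of_isCoprime hq hpq fun j => ∫ z, ψ z * N j z ∂μ,
    Finset.mul_sum, ← Finset.sum_sub_distrib]
  calc _ ≤ ∑ i ∈ Finset.range q, |ψ (F^[i] x : ℝ) - q * ∫ z, ψ z * N (J i) z ∂μ| :=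
        Finset.abs_sum_le_sum_abs _ _
    _ ≤ ∑ i ∈ Finset.range q, (W (a (J i + 1)) - W (a (J i))) := Finset.sum_le_sum hterm
    _ = ∑ j ∈ Finset.range q, (W (a (j + 1)) - W (a j)) :=
        sum_range_mul_emod_of_isCoprime hq hpq fun j => W (a (j + 1)) - W (a j)
    _ = V := by rw [Finset.sum_range_sub fun j => W (a j), haq, hW1]; ring

theorem hasDerivAt_iterate_of_forall_lt {f : ℝ → ℝ} {n : ℕ} {x : ℝ}
    (h : ∀ i < n, DifferentiableAt ℝ f (f^[i] x)) :
    HasDerivAt f^[n] (∏ i ∈ Finset.range n, deriv f (f^[i] x)) x := by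
  induction n with
  | zero => simpa using hasDerivAt_id x
  | succ n ih =>
    rw [Finset.prod_range_succ, mul_comm, Function.iterate_succ']
    exact (h n n.lt_succ_self).hasDerivAt.comp x (ih fun i hi => h i (hi.trans n.lt_succ_self))

/-- **Denjoy–Koksma inequality applied to the logarithm of the derivative.**  Let `F` be a
continuous strictly increasing lift of a circle homeomorphism `T` of `ℝ/ℤ` with irrational
rotation number `α ∈ (0,1)`.  Suppose `F` is differentiable with positive derivative off
the integer translates of a finite set `B ⊆ [0,1)`, and that the induced circle function
`ψ` of `log ∘ (deriv F)` has bounded variation `V` on `[0,1]`.  If `μ` is a `T`-invariant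
Borel probability measure and `q` is a convergent denominator of `α`, then for every `x`
whose first `q` iterates avoid `B` mod `1`,
`|log (deriv (F^[q]) x) − q·∫ ψ dμ| = |∑_{i<q} log (deriv F (F^[i] x)) − q·∫ ψ dμ| ≤ V`. -/
theorem denjoy_koksma_log_derivative
    (F : CircleDeg1Lift) (hFc : Continuous F) (hFs : StrictMono F)
    (T : AddCircle (1 : ℝ) → AddCircle (1 : ℝ))
    (hT : ∀ x : ℝ, T (x : AddCircle (1 : ℝ)) = (((F : ℝ → ℝ) x : ℝ) : AddCircle (1 : ℝ)))
    (α : ℝ) (hα_irr : Irrational α) (hα_mem : α ∈ Set.Ioo (0 : ℝ) 1)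
    (hρ : ∃ k : ℤ, F.translationNumber = α + k)
    (B : Finset ℝ) (hB : (B : Set ℝ) ⊆ Set.Ico (0 : ℝ) 1)
    (hdiff : ∀ x : ℝ, (∀ b ∈ B, ∀ k : ℤ, x ≠ b + k) →
      DifferentiableAt ℝ (F : ℝ → ℝ) x ∧ 0 < deriv (F : ℝ → ℝ) x)
    (ψ : AddCircle (1 : ℝ) → ℝ)
    (hψ : ∀ x : ℝ, (∀ b ∈ B, ∀ k : ℤ, x ≠ b + k) →
      ψ (x : AddCircle (1 : ℝ)) = Real.log (deriv (F : ℝ → ℝ) x))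
    (V : ℝ) (hV : 0 ≤ V)
    (hBV : eVariationOn (fun t : ℝ => ψ (t : AddCircle (1 : ℝ))) (Set.Icc 0 1)
      = ENNReal.ofReal V)
    (μ : Measure (AddCircle (1 : ℝ))) [IsProbabilityMeasure μ]
    (hμ : MeasurePreserving T μ μ)
    (q : ℕ) (hq1 : 1 ≤ q)
    (hq : ∃ n : ℕ, (q : ℝ) = (GenContFract.of α).dens n)
    (x : ℝ)
    (hx : ∀ i < q, ∀ b ∈ B, ∀ k : ℤ, (F : ℝ → ℝ)^[i] x ≠ b + k) :
    |(∑ i ∈ Finset.range q, Real.log (deriv (F : ℝ → ℝ) ((F : ℝ → ℝ)^[i] x)))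
        - q * ∫ z, ψ z ∂μ| ≤ V ∧
    |Real.log (deriv ((F : ℝ → ℝ)^[q]) x) - q * ∫ z, ψ z ∂μ| ≤ V := by
  have hD : ∀ i < q, DifferentiableAt ℝ (F : ℝ → ℝ) ((F : ℝ → ℝ)^[i] x) ∧
      0 < deriv (F : ℝ → ℝ) ((F : ℝ → ℝ)^[i] x) := fun i hi => hdiff _ (hx i hi)
  obtain ⟨k, hk⟩ := hρ
  obtain ⟨n, hn⟩ := hq
  obtain ⟨p, hpq, hp⟩ := GenContFract.exists_isCoprime_abs_sub_div_le hα_irr hq1 hn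
  have hirr : Irrational F.translationNumber := hk ▸ hα_irr.add_intCast k
  have hq0 : (q : ℝ) ≠ 0 := by positivity
  have hmain := F.denjoy_koksma hFs hT hμ hirr hq1 (p := p + k * q)
    (hpq.add_mul_right_left k)
    (by
      rw [hk]
      convert hp using 2
      push_cast
      field_simp
      ring) hV hBV x
  have hsum : ∑ i ∈ Finset.range q, ψ (((F : ℝ → ℝ)^[i] x : ℝ) : AddCircle (1 : ℝ)) =
      ∑ i ∈ Finset.range q, Real.log (deriv (F : ℝ → ℝ) ((F : ℝ → ℝ)^[i] x)) :=
    Finset.sum_congr rfl fun i hi => hψ _ (hx i (Finset.mem_range.1 hi))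
  rw [hsum] at hmain
  refine ⟨hmain, ?_⟩
  rwa [(hasDerivAt_iterate_of_forall_lt fun i hi => (hD i hi).1).deriv,
    Real.log_prod fun i hi => (hD i (Finset.mem_range.1 hi)).2.ne']
end
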